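/- Consider the $L_\infty$ approximation problem ${\rm APP} = \{{\rm APP}_{\infty,d}\}_{d \in \mathbb{N}}$ over the Korobov spaces with exponential weight $H(K_{d,\mathbf{a},\mathbf{b}})$ in the worst case setting, for either information class $\Lambda \in \{\Lambda^{\rm std}, \Lambda^{\rm all}\}$ and either error criterion $\star \in \{{\rm ABS}, {\rm NOR}\}$. Then ${\rm APP}$ is algebraically strongly polynomially tractable if and only if it is algebraically polynomially tractable, if and only if $\liminf_{j \to \infty} \frac{a_j}{\ln j} > \frac{1}{\ln \omega^{-1}}$. -/

import Mathlib

open Filter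
open scoped ENNReal NNReal

noncomputable section

/-- Coefficient space: `ℓ²` sequences indexed by `ℤ^d`.  An element `u` represents the
function `f ∈ H^ω(𝕋^d)` with Fourier coefficients `f̂(k) = u k / ω k`, so that
`‖u‖_{ℓ²} = ‖f‖_{H^ω}`. -/
abbrev Coef (d : ℕ) := lp (fun _ : Fin d → ℤ => ℂ) 2

/-- The periodic function represented by the coefficients `u`:
`f(x) = ∑_{k ∈ ℤ^d} (u k / ω k) e^{2πi k·x}`. -/
def torusFn {d : ℕ} (ω : (Fin d → ℤ) → ℝ) (u : Coef d) (x : Fin d → ℝ) : ℂ :=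
  ∑' k : Fin d → ℤ,
    ((ω k : ℂ))⁻¹ * u k * Complex.exp (2 * Real.pi * Complex.I * ∑ j, (k j : ℂ) * (x j : ℂ))

/-- The torus `𝕋^d`, modelled as the cube `[0,1]^d`. -/
def cube (d : ℕ) : Set (Fin d → ℝ) := {x | ∀ j, x j ∈ Set.Icc (0 : ℝ) 1}

/-- Standard information: point-evaluation functionals `f ↦ f(x)`. -/
def stdInfo {d : ℕ} (ω : (Fin d → ℤ) → ℝ) : Set (Coef d → ℂ) :=
  {L | ∃ x ∈ cube d, L = fun u => torusFn ω u x}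

/-- General linear information: all continuous linear functionals on `H^ω`. -/
def allInfo (d : ℕ) : Set (Coef d → ℂ) := {L | ∃ T : Coef d →L[ℂ] ℂ, L = ⇑T}

/-- The `n`-th minimal worst case error `e(n, APP_{∞,d}; Λ)` of `L_∞`-approximation on the
unit ball of `H^ω(𝕋^d)`, using algorithms `f ↦ φ(L₁ f, …, Lₙ f)` with `Lᵢ ∈ Λ`. -/
def wcErr {d : ℕ} (ω : (Fin d → ℤ) → ℝ) (Λ : Set (Coef d → ℂ)) (n : ℕ) : ℝ≥0∞ :=
  ⨅ (L : Fin n → Coef d → ℂ) (_ : ∀ i, L i ∈ Λ) (φ : (Fin n → ℂ) → (Fin d → ℝ) → ℂ),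
    ⨆ (u : Coef d) (_ : ‖u‖ ≤ 1) (x : Fin d → ℝ) (_ : x ∈ cube d),
      (‖torusFn ω u x - φ (fun i => L i u) x‖₊ : ℝ≥0∞)

/-- The initial error `e(0, APP_{∞,d}) = sup_{‖f‖_{H^ω} ≤ 1} ‖f‖_∞`. -/
def initErr {d : ℕ} (ω : (Fin d → ℤ) → ℝ) : ℝ≥0∞ :=
  ⨆ (u : Coef d) (_ : ‖u‖ ≤ 1) (x : Fin d → ℝ) (_ : x ∈ cube d),
    (‖torusFn ω u x‖₊ : ℝ≥0∞)

/-- The error criterion: absolute (ABS) or normalized (NOR). -/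
inductive Crit | ABS | NOR

/-- `CRI_d`: the normalizing quantity of the error criterion. -/
def CRI {d : ℕ} (ω : (Fin d → ℤ) → ℝ) : Crit → ℝ≥0∞
  | Crit.ABS => 1
  | Crit.NOR => initErr ω

/-- The information complexity `n^⋆(ε, d; Λ)`. -/
def infoComp {d : ℕ} (ω : (Fin d → ℤ) → ℝ) (Λ : Set (Coef d → ℂ)) (crit : Crit) (ε : ℝ) : ℕ :=
  sInf {n : ℕ | wcErr ω Λ n ≤ ENNReal.ofReal ε * CRI ω crit}

/-- Algebraic strong polynomial tractability of the family of information complexities `nc`. -/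
def ALGSPT (nc : ℕ → ℝ → ℕ) : Prop :=
  ∃ C > (0:ℝ), ∃ p ≥ (0:ℝ), ∀ d : ℕ, 0 < d → ∀ ε ∈ Set.Ioo (0:ℝ) 1,
    (nc d ε : ℝ) ≤ C * ε ^ (-p)

/-- The exponent of algebraic strong polynomial tractability. -/
def ALGSPTexp (nc : ℕ → ℝ → ℕ) : ℝ :=
  sInf {p : ℝ | 0 ≤ p ∧ ∃ C > (0:ℝ), ∀ d : ℕ, 0 < d → ∀ ε ∈ Set.Ioo (0:ℝ) 1,
    (nc d ε : ℝ) ≤ C * ε ^ (-p)}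

/-- Algebraic polynomial tractability. -/
def ALGPT (nc : ℕ → ℝ → ℕ) : Prop :=
  ∃ C > (0:ℝ), ∃ p ≥ (0:ℝ), ∃ q ≥ (0:ℝ), ∀ d : ℕ, 0 < d → ∀ ε ∈ Set.Ioo (0:ℝ) 1,
    (nc d ε : ℝ) ≤ C * (d : ℝ) ^ q * ε ^ (-p)

/-- Algebraic quasi-polynomial tractability. -/
def ALGQPT (nc : ℕ → ℝ → ℕ) : Prop :=
  ∃ C > (0:ℝ), ∃ t ≥ (0:ℝ), ∀ d : ℕ, 0 < d → ∀ ε ∈ Set.Ioo (0:ℝ) 1,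
    (nc d ε : ℝ) ≤ C * Real.exp (t * (1 + Real.log d) * (1 + Real.log ε⁻¹))

/-- The exponent of algebraic quasi-polynomial tractability. -/
def ALGQPTexp (nc : ℕ → ℝ → ℕ) : ℝ :=
  sInf {t : ℝ | 0 ≤ t ∧ ∃ C > (0:ℝ), ∀ d : ℕ, 0 < d → ∀ ε ∈ Set.Ioo (0:ℝ) 1,
    (nc d ε : ℝ) ≤ C * Real.exp (t * (1 + Real.log d) * (1 + Real.log ε⁻¹))}

/-- Exponential quasi-polynomial tractability. -/
def EXPQPT (nc : ℕ → ℝ → ℕ) : Prop :=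
  ∃ C > (0:ℝ), ∃ t ≥ (0:ℝ), ∀ d : ℕ, 0 < d → ∀ ε ∈ Set.Ioo (0:ℝ) 1,
    (nc d ε : ℝ) ≤ C * Real.exp (t * (1 + Real.log d) * (1 + Real.log (Real.log ε⁻¹ + 1)))

/-- The exponent of exponential quasi-polynomial tractability. -/
def EXPQPTexp (nc : ℕ → ℝ → ℕ) : ℝ :=
  sInf {t : ℝ | 0 ≤ t ∧ ∃ C > (0:ℝ), ∀ d : ℕ, 0 < d → ∀ ε ∈ Set.Ioo (0:ℝ) 1,
    (nc d ε : ℝ) ≤ C * Real.exp (t * (1 + Real.log d) * (1 + Real.log (Real.log ε⁻¹ + 1)))}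

/-- `lim_{ε⁻¹ + d → ∞} (log nc(d, ε)) / den(d, ε) = 0`. -/
def WTlim (den : ℕ → ℝ → ℝ) (nc : ℕ → ℝ → ℕ) : Prop :=
  ∀ δ > (0:ℝ), ∃ M : ℝ, ∀ d : ℕ, 0 < d → ∀ ε ∈ Set.Ioo (0:ℝ) 1,
    M ≤ ε⁻¹ + d → |Real.log (nc d ε) / den d ε| < δ

/-- Algebraic `(s,t)`-weak tractability; `ALGWTst 1 1` is algebraic weak tractability. -/
def ALGWTst (s t : ℝ) (nc : ℕ → ℝ → ℕ) : Prop :=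
  WTlim (fun d ε => ε ^ (-s) + (d : ℝ) ^ t) nc

/-- Algebraic uniform weak tractability. -/
def ALGUWT (nc : ℕ → ℝ → ℕ) : Prop := ∀ α > (0:ℝ), ∀ β > (0:ℝ), ALGWTst α β nc

/-- Exponential `(s,t)`-weak tractability; `EXPWTst 1 1` is exponential weak tractability. -/
def EXPWTst (s t : ℝ) (nc : ℕ → ℝ → ℕ) : Prop :=
  WTlim (fun d ε => (1 + Real.log ε⁻¹) ^ s + (d : ℝ) ^ t) nc

/-- Exponential uniform weak tractability. -/
def EXPUWT (nc : ℕ → ℝ → ℕ) : Prop := ∀ α > (0:ℝ), ∀ β > (0:ℝ), EXPWTst α β nc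

/-- The weight of the Korobov space with exponential weight `H(K_{d,a,b})`:
`ω_d(h) = ω_h^{-1/2}` where `ω_h = ω^{∑_k a_k |h_k|^{b_k}}` (coordinate `k` uses
`a_{k+1}, b_{k+1}`, the sequences being indexed starting from `1`). -/
def expKorWeight (w : ℝ) (a b : ℕ → ℝ) (d : ℕ) (h : Fin d → ℤ) : ℝ :=
  w ^ (-(∑ j : Fin d, a (j.1 + 1) * (|h j| : ℝ) ^ b (j.1 + 1)) / 2)

/-- The information complexity function of `L_∞`-approximation over the Korobov spaces
with exponential weight, for `Λ^std` (`useStd = true`) or `Λ^all` (`useStd = false`). -/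
def expKorNC (w : ℝ) (a b : ℕ → ℝ) (useStd : Bool) (crit : Crit) : ℕ → ℝ → ℕ := fun d ε =>
  infoComp (expKorWeight w a b d) (if useStd then stdInfo (expKorWeight w a b d) else allInfo d)
    crit ε

/-- The character `e^{2πi k·x}`. -/
def ch {d : ℕ} (k : Fin d → ℤ) (x : Fin d → ℝ) : ℂ :=
  Complex.exp (2 * Real.pi * Complex.I * ∑ j, (k j : ℂ) * (x j : ℂ))

lemma ch_eq {d : ℕ} (k : Fin d → ℤ) (x : Fin d → ℝ) :
    ch k x = Complex.exp (((2 * Real.pi * ∑ j, (k j : ℝ) * x j : ℝ) : ℂ) * Complex.I) := by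
  unfold ch; congr 1; push_cast; ring

lemma norm_ch {d : ℕ} (k : Fin d → ℤ) (x : Fin d → ℝ) : ‖ch k x‖ = 1 := by
  rw [ch_eq, Complex.norm_exp_ofReal_mul_I]

lemma conj_ch {d : ℕ} (k : Fin d → ℤ) (x : Fin d → ℝ) :
    (starRingEnd ℂ) (ch k x) = ch (-k) x := by
  rw [ch_eq, ch_eq, ← Complex.exp_conj]
  congr 1
  rw [map_mul, Complex.conj_ofReal, Complex.conj_I]
  push_cast
  simp

lemma ch_mul {d : ℕ} (k h : Fin d → ℤ) (x : Fin d → ℝ) :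
    ch k x * ch h x = ch (k + h) x := by
  unfold ch
  rw [← Complex.exp_add]; congr 1
  simp [add_mul, Finset.sum_add_distrib, mul_add]

lemma exists_gen {d p : ℕ} [Fact p.Prime] (B : Finset (Fin d → ZMod p)) (h0 : 0 ∉ B)
    (hc : B.card < p) : ∃ z : Fin d → ZMod p, ∀ v ∈ B, ∑ j, v j * z j ≠ 0 := by
  classical
  by_contra hcon
  push Not at hcon
  have hcov : (Finset.univ : Finset (Fin d → ZMod p)) ⊆
      B.biUnion (fun v => Finset.univ.filter (fun z => ∑ j, v j * z j = 0)) := by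
    intro z _
    obtain ⟨v, hv, hz⟩ := hcon z
    simp only [Finset.mem_biUnion, Finset.mem_filter, Finset.mem_univ, true_and]
    exact ⟨v, hv, hz⟩
  have hone : ∀ v ∈ B, (Finset.univ.filter (fun z : Fin d → ZMod p => ∑ j, v j * z j = 0)).card * p
      ≤ Fintype.card (Fin d → ZMod p) := by
    intro v hv
    have hv0 : v ≠ 0 := fun h => h0 (h ▸ hv)
    obtain ⟨j0, hj0⟩ := Function.ne_iff.mp hv0
    have hj0 : v j0 ≠ 0 := hj0
    have : ((Finset.univ.filter (fun z : Fin d → ZMod p => ∑ j, v j * z j = 0)) ×ˢ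
        (Finset.univ : Finset (ZMod p))).card ≤ (Finset.univ : Finset (Fin d → ZMod p)).card := by
      apply Finset.card_le_card_of_injOn (fun q => q.1 + Pi.single j0 q.2)
      · intro q _; simp
      · rintro ⟨z, t⟩ hz ⟨z', t'⟩ hz' heq
        simp only [Finset.coe_product, Set.mem_prod, Finset.coe_filter, Finset.mem_univ, true_and,
          Set.mem_ofPred_eq, Finset.coe_univ, Set.mem_univ, and_true] at hz hz'
        simp only at heq
        have key : ∀ (z : Fin d → ZMod p) (t : ZMod p), ∑ j, v j * z j = 0 →
            ∑ j, v j * (z + Pi.single j0 t : Fin d → ZMod p) j = v j0 * t := by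
          intro z t hz
          simp only [Pi.add_apply, mul_add, Finset.sum_add_distrib, hz, zero_add]
          rw [Finset.sum_eq_single j0]
          · simp
          · intro b _ hb; simp [Pi.single_eq_of_ne hb]
          · simp
        have h1 := key z t hz
        have h2 := key z' t' hz'
        rw [heq, h2] at h1
        have ht : t' = t := mul_left_cancel₀ hj0 h1
        subst ht
        simpa using heq
    rw [Finset.card_product] at this
    simpa [ZMod.card] using this
  have hle := (Finset.card_le_card hcov).trans Finset.card_biUnion_le
  have h3 : (∑ v ∈ B, (Finset.univ.filter (fun z : Fin d → ZMod p => ∑ j, v j * z j = 0)).card) * p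
      ≤ B.card * Fintype.card (Fin d → ZMod p) := by
    rw [Finset.sum_mul]
    exact (Finset.sum_le_sum hone).trans (by simp)
  have hpos : 0 < Fintype.card (Fin d → ZMod p) := Fintype.card_pos
  rw [Finset.card_univ] at hle
  have h4 := (Nat.mul_le_mul_right p hle).trans h3
  have h5 := Nat.mul_lt_mul_of_pos_right hc hpos
  rw [mul_comm] at h4
  omega

lemma exists_lattice {d p : ℕ} [hp : Fact p.Prime] (B : Finset (Fin d → ℤ)) (hB : B.card ^ 2 < p)
    (hd : ∀ h ∈ B, ∀ k ∈ B, ∀ j, |h j - k j| < p) :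
    ∃ (x : Fin p → Fin d → ℝ) (c : (Fin d → ℤ) → ZMod p), (∀ i, x i ∈ cube d) ∧
      Set.InjOn c B ∧ ∀ k h : Fin d → ℤ,
        ∑ i, ch k (x i) * ch (-h) (x i) = if c k = c h then (p : ℂ) else 0 := by
  classical
  have : NeZero p := ⟨hp.out.ne_zero⟩
  let red : (Fin d → ℤ) × (Fin d → ℤ) → (Fin d → ZMod p) := fun q j => ((q.1 j - q.2 j : ℤ) : ZMod p)
  obtain ⟨z, hz⟩ := exists_gen ((B.offDiag).image red) (by
    intro h
    obtain ⟨⟨h, k⟩, hq, h0⟩ := Finset.mem_image.mp h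
    obtain ⟨h1, h2, h3⟩ := Finset.mem_offDiag.mp hq
    apply h3
    funext j
    have h4 := congrFun h0 j
    simp only [red, Pi.zero_apply] at h4
    have h5 := (ZMod.intCast_zmod_eq_zero_iff_dvd _ p).mp h4
    have h6 := Int.eq_zero_of_abs_lt_dvd h5 (hd h h1 k h2 j)
    simpa [sub_eq_zero] using h6) (by
    refine lt_of_le_of_lt Finset.card_image_le ?_
    rw [Finset.offDiag_card]
    have : B.card ^ 2 = B.card * B.card := sq _
    omega)
  refine ⟨fun i j => Int.fract ((i.1 : ℝ) * ((z j).val : ℝ) / p),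
    fun k => ∑ j, (k j : ZMod p) * z j, ?_, ?_, ?_⟩
  · intro i j
    exact ⟨Int.fract_nonneg _, (Int.fract_lt_one _).le⟩
  · intro h hh k hk heq
    by_contra hne
    apply hz (red (h, k)) (Finset.mem_image_of_mem _ (Finset.mem_offDiag.mpr ⟨hh, hk, hne⟩))
    simp only [red]
    push_cast
    simp only [sub_mul, Finset.sum_sub_distrib]
    simp only at heq
    rw [heq, sub_self]
  · intro k h
    have key : ∀ i : Fin p, ch k (fun j => Int.fract ((i.1 : ℝ) * ((z j).val : ℝ) / p)) *
        ch (-h) (fun j => Int.fract ((i.1 : ℝ) * ((z j).val : ℝ) / p)) =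
        ZMod.stdAddChar ((i.1 : ZMod p) * (∑ j, (k j : ZMod p) * z j - ∑ j, (h j : ZMod p) * z j)) := by
      intro i
      rw [ch_mul]
      have : ((i.1 : ZMod p) * (∑ j, (k j : ZMod p) * z j - ∑ j, (h j : ZMod p) * z j)) =
          ((∑ j, (k + -h) j * ((i.1 : ℤ) * ((z j).val : ℤ)) : ℤ) : ZMod p) := by
        push_cast
        simp only [ZMod.natCast_val, ZMod.cast_id', id, Pi.add_apply, Pi.neg_apply]
        rw [← Finset.sum_sub_distrib, Finset.mul_sum]
        refine Finset.sum_congr rfl fun j _ => ?_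
        push_cast; ring
      rw [this, ZMod.stdAddChar_coe]
      unfold ch
      rw [Complex.exp_eq_exp_iff_exists_int]
      refine ⟨-∑ j, (k + -h) j * ⌊((i.1 : ℝ) * ((z j).val : ℝ) / p)⌋, ?_⟩
      simp only [Int.fract]
      push_cast
      have hpc : (p : ℂ) ≠ 0 := by exact_mod_cast hp.out.ne_zero
      rw [mul_div_assoc, Finset.sum_div, neg_mul, Finset.sum_mul, Finset.mul_sum, Finset.mul_sum,
        ← sub_eq_add_neg (∑ i_1, _), ← Finset.sum_sub_distrib]
      refine Finset.sum_congr rfl fun j _ => ?_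
      field_simp
    rw [Finset.sum_congr rfl (fun i _ => key i)]
    have hs := AddChar.sum_mulShift (∑ j, (k j : ZMod p) * z j - ∑ j, (h j : ZMod p) * z j)
      (ZMod.isPrimitive_stdAddChar p)
    rw [ZMod.card] at hs
    have h2 : ∑ i : Fin p, ZMod.stdAddChar ((i.1 : ZMod p) *
        (∑ j, (k j : ZMod p) * z j - ∑ j, (h j : ZMod p) * z j)) =
        ∑ t : ZMod p, ZMod.stdAddChar (t *
        (∑ j, (k j : ZMod p) * z j - ∑ j, (h j : ZMod p) * z j)) := by
      refine Finset.sum_bij (fun i _ => (i.1 : ZMod p)) (by simp) ?_ ?_ (by simp)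
      · intro i _ j _ hij
        have := congrArg ZMod.val hij
        rw [ZMod.val_natCast_of_lt i.2, ZMod.val_natCast_of_lt j.2] at this
        exact Fin.ext this
      · intro t _
        exact ⟨⟨t.val, ZMod.val_lt t⟩, Finset.mem_univ _, by simp⟩
    rw [h2, hs]
    simp only [sub_eq_zero]
    split_ifs <;> simp

lemma coef_hasSum {d : ℕ} (u : Coef d) : HasSum (fun k => ‖u k‖ ^ 2) (‖u‖ ^ 2) := by
  have h := lp.hasSum_norm (p := 2) (by norm_num) u
  simpa using h

lemma coef_cs {d : ℕ} (v : (Fin d → ℤ) → ℝ) (hv : ∀ k, 0 ≤ v k) (hs : Summable fun k => v k ^ 2)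
    (u : Coef d) : Summable (fun k => v k * ‖u k‖) ∧
      ∑' k, v k * ‖u k‖ ≤ Real.sqrt (∑' k, v k ^ 2) * ‖u‖ := by
  have h2 : (2:ℝ).HolderConjugate 2 := by
    rw [Real.holderConjugate_iff]; norm_num
  have hu := coef_hasSum u
  have hs' : Summable fun k => v k ^ (2:ℝ) := by simpa using hs
  have hu' : Summable fun k => ‖u k‖ ^ (2:ℝ) := by simpa using hu.summable
  refine ⟨Real.summable_mul_of_Lp_Lq_of_nonneg h2 hv (fun _ => norm_nonneg _) hs' hu', ?_⟩
  have h := Real.inner_le_Lp_mul_Lq_tsum_of_nonneg h2 hv (fun k => norm_nonneg (u k)) hs' hu'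
  rw [← Real.sqrt_eq_rpow, ← Real.sqrt_eq_rpow] at h
  simp only [Real.rpow_two] at h
  rw [hu.tsum_eq, Real.sqrt_sq (norm_nonneg _)] at h
  exact h

lemma torus_summable {d : ℕ} (ω : (Fin d → ℤ) → ℝ) (hω : ∀ k, 0 < ω k)
    (hs : Summable fun k => (ω k)⁻¹ ^ 2) (u : Coef d) (x : Fin d → ℝ) :
    Summable (fun k => ((ω k : ℂ))⁻¹ * u k * ch k x) := by
  apply Summable.of_norm
  refine (coef_cs (fun k => (ω k)⁻¹) (fun k => (inv_pos.mpr (hω k)).le) hs u).1.congr fun k => ?_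
  rw [norm_mul, norm_ch, norm_mul, norm_inv, Complex.norm_real, Real.norm_of_nonneg (hω k).le]
  ring

lemma torus_norm {d : ℕ} (ω : (Fin d → ℤ) → ℝ) (hω : ∀ k, 0 < ω k)
    (hs : Summable fun k => (ω k)⁻¹ ^ 2) (u : Coef d) (x : Fin d → ℝ) :
    ‖torusFn ω u x‖ ≤ Real.sqrt (∑' k, (ω k)⁻¹ ^ 2) * ‖u‖ := by
  have h := coef_cs (fun k => (ω k)⁻¹) (fun k => (inv_pos.mpr (hω k)).le) hs u
  refine le_trans ?_ h.2
  refine tsum_of_norm_bounded h.1.hasSum fun k => ?_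
  change ‖((ω k : ℂ))⁻¹ * u k * ch k x‖ ≤ _
  rw [norm_mul, norm_ch, norm_mul, norm_inv, Complex.norm_real, Real.norm_of_nonneg (hω k).le]
  simp

/-- Point evaluation as a linear map. -/
def evalLin {d : ℕ} (ω : (Fin d → ℤ) → ℝ) (hω : ∀ k, 0 < ω k)
    (hs : Summable fun k => (ω k)⁻¹ ^ 2) (x : Fin d → ℝ) : Coef d →ₗ[ℂ] ℂ where
  toFun u := torusFn ω u x
  map_add' u v := by
    change ∑' k, _ * ch k x = ∑' k, _ * ch k x + ∑' k, _ * ch k x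
    rw [← (torus_summable ω hω hs u x).tsum_add (torus_summable ω hω hs v x)]
    refine tsum_congr fun k => ?_
    simp only [lp.coeFn_add, Pi.add_apply]; ring
  map_smul' c u := by
    change ∑' k, _ * ch k x = c • ∑' k, _ * ch k x
    rw [← (torus_summable ω hω hs u x).tsum_const_smul]
    refine tsum_congr fun k => ?_
    simp only [lp.coeFn_smul, Pi.smul_apply, smul_eq_mul]; ring

lemma std_subset {d : ℕ} (ω : (Fin d → ℤ) → ℝ) (hω : ∀ k, 0 < ω k)
    (hs : Summable fun k => (ω k)⁻¹ ^ 2) : stdInfo ω ⊆ allInfo d := by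
  rintro L ⟨x, -, rfl⟩
  exact ⟨(evalLin ω hω hs x).mkContinuous _ (fun u => torus_norm ω hω hs u x), rfl⟩

lemma wcErr_mono {d : ℕ} (ω : (Fin d → ℤ) → ℝ) (Λ Λ' : Set (Coef d → ℂ)) (h : Λ ⊆ Λ') (n : ℕ) :
    wcErr ω Λ' n ≤ wcErr ω Λ n := by
  unfold wcErr
  refine le_iInf fun L => le_iInf fun hL => ?_
  exact iInf₂_le L (fun i => h (hL i))

lemma initErr_le {d : ℕ} (ω : (Fin d → ℤ) → ℝ) (hω : ∀ k, 0 < ω k)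
    (hs : Summable fun k => (ω k)⁻¹ ^ 2) :
    initErr ω ≤ ENNReal.ofReal (Real.sqrt (∑' k, (ω k)⁻¹ ^ 2)) := by
  unfold initErr
  refine iSup₂_le fun u hu => iSup₂_le fun x _ => ?_
  rw [← enorm_eq_nnnorm, ← ofReal_norm]
  apply ENNReal.ofReal_le_ofReal
  refine (torus_norm ω hω hs u x).trans ?_
  exact mul_le_of_le_one_right (Real.sqrt_nonneg _) hu

lemma wcErr_std_le {d p : ℕ} (hp : p.Prime) (ω : (Fin d → ℤ) → ℝ) (hω : ∀ k, 0 < ω k)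
    (hs : Summable fun k => (ω k)⁻¹ ^ 2) (A : Finset (Fin d → ℤ)) (hA : A.card ^ 2 < p)
    (hd : ∀ h ∈ A, ∀ k ∈ A, ∀ j, |h j - k j| < p) (R : ℝ)
    (hR : ∀ F : Finset (Fin d → ℤ), Disjoint F A → ∑ k ∈ F, (ω k)⁻¹ ^ 2 ≤ R) :
    wcErr ω (stdInfo ω) p ≤ ENNReal.ofReal (2 * Real.sqrt R) := by
  classical
  have : Fact p.Prime := ⟨hp⟩
  have hpc : (p : ℂ) ≠ 0 := by exact_mod_cast hp.ne_zero
  obtain ⟨x, c, hx, hinj, horth⟩ := exists_lattice A hA hd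
  unfold wcErr
  refine iInf_le_of_le (fun i u => torusFn ω u (x i)) ?_
  refine iInf_le_of_le (fun i => ⟨x i, hx i, rfl⟩) ?_
  refine iInf_le_of_le (fun y t => ∑ h ∈ A, ((p : ℂ)⁻¹ * ∑ i, y i * ch (-h) (x i)) * ch h t) ?_
  refine iSup₂_le fun u hu => iSup₂_le fun t _ => ?_
  rw [← enorm_eq_nnnorm, ← ofReal_norm]
  apply ENNReal.ofReal_le_ofReal
  set g : (Fin d → ℤ) → ℂ := fun k => ((ω k : ℂ))⁻¹ * u k with hg
  have hsum : ∀ t, HasSum (fun k => g k * ch k t) (torusFn ω u t) :=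
    fun t => (torus_summable ω hω hs u t).hasSum
  have hcoef : ∀ h, HasSum (fun k => g k * if c k = c h then 1 else 0)
      ((p : ℂ)⁻¹ * ∑ i, torusFn ω u (x i) * ch (-h) (x i)) := by
    intro h
    have h1 : HasSum (fun k => ∑ i, (g k * ch k (x i)) * ch (-h) (x i))
        (∑ i, torusFn ω u (x i) * ch (-h) (x i)) :=
      hasSum_sum fun i _ => (hsum (x i)).mul_right _
    refine (h1.mul_left (p : ℂ)⁻¹).congr_fun ?_
    intro k
    simp only [mul_assoc]
    rw [← Finset.mul_sum, horth]
    split_ifs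
    · field_simp
    · simp
  have htot := (hsum t).sub (hasSum_sum (s := A) fun h _ => (hcoef h).mul_right (ch h t))
  set v : (Fin d → ℤ) → ℝ := fun k => if k ∈ A then 0 else (ω k)⁻¹ with hv
  have hvsq : ∀ k, v k ^ 2 = if k ∈ A then 0 else (ω k)⁻¹ ^ 2 := by
    intro k; simp only [hv]; split_ifs <;> simp
  have hv0 : ∀ k, 0 ≤ v k := by
    intro k; simp only [hv]; split_ifs; exacts [le_rfl, (inv_pos.mpr (hω k)).le]
  have hvF : ∀ F : Finset (Fin d → ℤ), ∑ k ∈ F, v k ^ 2 ≤ R := by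
    intro F
    have := hR (F \ A) Finset.sdiff_disjoint
    refine le_trans (le_of_eq ?_) this
    rw [← Finset.filter_notMem_eq_sdiff, Finset.sum_filter]
    refine Finset.sum_congr rfl fun k _ => ?_
    rw [hvsq]; split_ifs <;> simp_all
  have hvs : Summable fun k => v k ^ 2 := summable_of_sum_le (fun k => sq_nonneg _) hvF
  have hcs := coef_cs v hv0 hvs u
  have hvt : ∑' k, v k ^ 2 ≤ R := hvs.tsum_le_of_sum_le hvF
  rw [← htot.tsum_eq]
  have hb : ∀ k, ‖g k * ch k t - ∑ h ∈ A, (g k * if c k = c h then 1 else 0) * ch h t‖ ≤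
      2 * (v k * ‖u k‖) := by
    intro k
    have e1 : g k * ch k t - ∑ h ∈ A, (g k * if c k = c h then 1 else 0) * ch h t =
        g k * (ch k t - ∑ h ∈ A.filter (fun h => c k = c h), ch h t) := by
      rw [mul_sub, Finset.sum_filter, Finset.mul_sum]
      congr 1
      refine Finset.sum_congr rfl fun h _ => ?_
      split_ifs <;> simp
    rw [e1]
    by_cases hk : k ∈ A
    · have : A.filter (fun h => c k = c h) = {k} := by
        ext h
        simp only [Finset.mem_filter, Finset.mem_singleton]
        constructor
        · rintro ⟨h1, h2⟩; exact (hinj hk h1 h2).symm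
        · rintro rfl; exact ⟨hk, rfl⟩
      rw [this]
      simp [hv, hk]
    · have hcard : (A.filter (fun h => c k = c h)).card ≤ 1 := by
        rw [Finset.card_le_one]
        intro h1 hh1 h2 hh2
        rw [Finset.mem_filter] at hh1 hh2
        exact hinj hh1.1 hh2.1 (hh1.2.symm.trans hh2.2)
      have h2 : ‖ch k t - ∑ h ∈ A.filter (fun h => c k = c h), ch h t‖ ≤ 2 := by
        refine (norm_sub_le _ _).trans ?_
        have h3 : ‖∑ h ∈ A.filter (fun h => c k = c h), ch h t‖ ≤ 1 := by
          refine (norm_sum_le _ _).trans ?_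
          simp only [norm_ch, Finset.sum_const, nsmul_eq_mul, mul_one]
          exact_mod_cast hcard
        rw [norm_ch]; linarith
      have h4 : ‖g k‖ = v k * ‖u k‖ := by
        simp only [hg, hv, hk, if_false, norm_mul, norm_inv, Complex.norm_real,
          Real.norm_of_nonneg (hω k).le]
      rw [norm_mul, h4, mul_comm]
      exact mul_le_mul_of_nonneg_right h2 (mul_nonneg (hv0 k) (norm_nonneg _))
  refine (tsum_of_norm_bounded (hcs.1.hasSum.mul_left 2) hb).trans ?_
  have h5 : Real.sqrt (∑' k, v k ^ 2) * ‖u‖ ≤ Real.sqrt R :=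
    (mul_le_of_le_one_right (Real.sqrt_nonneg _) hu).trans (Real.sqrt_le_sqrt hvt)
  linarith [hcs.2]

lemma parseval {d p : ℕ} (B : Finset (Fin d → ℤ)) (x : Fin p → Fin d → ℝ)
    (c : (Fin d → ℤ) → ZMod p) (hinj : Set.InjOn c B)
    (horth : ∀ k h : Fin d → ℤ,
        ∑ i, ch k (x i) * ch (-h) (x i) = if c k = c h then (p : ℂ) else 0)
    (g : (Fin d → ℤ) → ℂ) :
    ∑ i, ‖∑ k ∈ B, g k * ch k (x i)‖ ^ 2 = p * ∑ k ∈ B, ‖g k‖ ^ 2 := by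
  classical
  have h : (((∑ i, ‖∑ k ∈ B, g k * ch k (x i)‖ ^ 2 : ℝ)) : ℂ) =
      ((p * ∑ k ∈ B, ‖g k‖ ^ 2 : ℝ) : ℂ) := by
    push_cast
    simp only [← Complex.mul_conj', map_sum, map_mul, conj_ch]
    simp only [Finset.sum_mul_sum]
    rw [Finset.sum_comm, Finset.mul_sum]
    refine Finset.sum_congr rfl fun k hk => ?_
    rw [Finset.sum_comm, Finset.sum_eq_single k]
    · have : ∀ i, g k * ch k (x i) * ((starRingEnd ℂ) (g k) * ch (-k) (x i)) =
        (g k * (starRingEnd ℂ) (g k)) * (ch k (x i) * ch (-k) (x i)) := fun i => by ring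
      simp only [this]
      rw [← Finset.mul_sum, horth, if_pos rfl]; ring
    · intro h hh hne
      have : ∀ i, g k * ch k (x i) * ((starRingEnd ℂ) (g h) * ch (-h) (x i)) =
        (g k * (starRingEnd ℂ) (g h)) * (ch k (x i) * ch (-h) (x i)) := fun i => by ring
      simp only [this]
      rw [← Finset.mul_sum, horth, if_neg, mul_zero]
      intro hc; exact hne (hinj hk hh hc).symm
    · intro h; exact absurd hk h
  exact_mod_cast h

lemma exists_lattice' {d : ℕ} (B : Finset (Fin d → ℤ)) :
    ∃ (p : ℕ) (x : Fin p → Fin d → ℝ) (c : (Fin d → ℤ) → ZMod p), p.Prime ∧ (∀ i, x i ∈ cube d) ∧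
      Set.InjOn c B ∧ ∀ k h : Fin d → ℤ,
        ∑ i, ch k (x i) * ch (-h) (x i) = if c k = c h then (p : ℂ) else 0 := by
  obtain ⟨p, hp, hpp⟩ := Nat.exists_infinite_primes
    (B.card ^ 2 + ∑ h ∈ B, ∑ k ∈ B, ∑ j, (h j - k j).natAbs + 1)
  have : Fact p.Prime := ⟨hpp⟩
  obtain ⟨x, c, h⟩ := exists_lattice (p := p) B (by omega) (by
    intro h hh k hk j
    have h1 : (h j - k j).natAbs ≤ ∑ j, (h j - k j).natAbs :=
      Finset.single_le_sum (f := fun j => (h j - k j).natAbs) (fun _ _ => Nat.zero_le _)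
        (Finset.mem_univ j)
    have h2 : ∑ j, (h j - k j).natAbs ≤ ∑ k ∈ B, ∑ j, (h j - k j).natAbs :=
      Finset.single_le_sum (f := fun k : Fin d → ℤ => ∑ j, (h j - k j).natAbs)
        (fun _ _ => Nat.zero_le _) hk
    have h3 : ∑ k ∈ B, ∑ j, (h j - k j).natAbs ≤ ∑ h ∈ B, ∑ k ∈ B, ∑ j, (h j - k j).natAbs :=
      Finset.single_le_sum (f := fun h : Fin d → ℤ => ∑ k ∈ B, ∑ j, (h j - k j).natAbs)
        (fun _ _ => Nat.zero_le _) hh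
    rw [Int.abs_eq_natAbs]
    omega)
  exact ⟨p, x, c, hpp, h⟩

/-- Embedding of finitely supported coefficients. -/
def emb {d : ℕ} (B : Finset (Fin d → ℤ)) : EuclideanSpace ℂ B →ₗ[ℂ] Coef d where
  toFun v := ⟨fun k => if h : k ∈ B then v ⟨k, h⟩ else 0, by
    refine memℓp_gen ?_
    refine summable_of_ne_finset_zero (s := B) fun k hk => ?_
    simp [hk]⟩
  map_add' v w := by
    ext k
    simp only [lp.coeFn_add, Pi.add_apply]
    split_ifs <;> simp
  map_smul' c w := by
    ext k
    simp only [lp.coeFn_smul, Pi.smul_apply]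
    split_ifs <;> simp

lemma emb_apply {d : ℕ} (B : Finset (Fin d → ℤ)) (v : EuclideanSpace ℂ B) (k : Fin d → ℤ) :
    emb B v k = if h : k ∈ B then v ⟨k, h⟩ else 0 := rfl

lemma norm_emb {d : ℕ} (B : Finset (Fin d → ℤ)) (v : EuclideanSpace ℂ B) : ‖emb B v‖ = ‖v‖ := by
  have h1 := (coef_hasSum (emb B v)).tsum_eq
  rw [tsum_eq_sum (s := B) (by intro k hk; simp [emb_apply, hk])] at h1
  have h2 := EuclideanSpace.norm_sq_eq v
  have h3 : ∑ k ∈ B, ‖emb B v k‖ ^ 2 = ∑ k : B, ‖v k‖ ^ 2 := by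
    rw [← Finset.sum_coe_sort]
    refine Finset.sum_congr rfl fun k _ => ?_
    rw [emb_apply, dif_pos k.2]
  rw [h3, ← h2] at h1
  exact ((sq_eq_sq₀ (norm_nonneg _) (norm_nonneg _)).mp h1).symm

lemma torus_emb {d : ℕ} (ω : (Fin d → ℤ) → ℝ) (B : Finset (Fin d → ℤ)) (v : EuclideanSpace ℂ B)
    (x : Fin d → ℝ) : torusFn ω (emb B v) x = ∑ k ∈ B, ((ω k : ℂ))⁻¹ * emb B v k * ch k x := by
  unfold torusFn
  rw [tsum_eq_sum (s := B)]
  · rfl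
  · intro k hk; simp [emb_apply, hk]

lemma lower {d : ℕ} (ω : (Fin d → ℤ) → ℝ) (hω : ∀ k, 0 < ω k)
    (hs : Summable fun k => (ω k)⁻¹ ^ 2) (n : ℕ) (B : Finset (Fin d → ℤ)) (Q : ℝ)
    (hQ : ∀ m : (Fin d → ℤ) → ℝ, (∀ k, 0 ≤ m k ∧ m k ≤ 1) → ∑ k ∈ B, m k ≤ n →
      Q ≤ ∑ k ∈ B, (ω k)⁻¹ ^ 2 * (1 - m k)) :
    ENNReal.ofReal (Real.sqrt Q) ≤ wcErr ω (allInfo d) n := by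
  classical
  unfold wcErr
  refine le_iInf fun L => le_iInf fun hL => le_iInf fun φ => ?_
  choose T hT using hL
  set S := (⨆ (u : Coef d) (_ : ‖u‖ ≤ 1) (x : Fin d → ℝ) (_ : x ∈ cube d),
      (‖torusFn ω u x - φ (fun i => L i u) x‖₊ : ℝ≥0∞)) with hS
  by_cases htop : S = ⊤
  · rw [htop]; exact le_top
  set s := S.toReal with hs_def
  have hSs : S = ENNReal.ofReal s := (ENNReal.ofReal_toReal htop).symm
  rw [hSs]
  apply ENNReal.ofReal_le_ofReal
  have hs0 : 0 ≤ s := ENNReal.toReal_nonneg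
  have hbd : ∀ u : Coef d, ‖u‖ ≤ 1 → ∀ x ∈ cube d,
      ‖torusFn ω u x - φ (fun i => L i u) x‖ ≤ s := by
    intro u hu x hx
    have h1 : (‖torusFn ω u x - φ (fun i => L i u) x‖₊ : ℝ≥0∞) ≤ S := by
      rw [hS]
      exact le_iSup₂_of_le u hu (le_iSup₂_of_le x hx le_rfl)
    rw [hSs, ← enorm_eq_nnnorm, ← ofReal_norm, ENNReal.ofReal_le_ofReal_iff hs0] at h1
    exact h1
  let ev := fun x => evalLin ω hω hs x
  have hev : ∀ x u, ev x u = torusFn ω u x := fun _ _ => rfl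
  have hker1 : ∀ u : Coef d, ‖u‖ ≤ 1 → (∀ i, T i u = 0) → ∀ x ∈ cube d, ‖ev x u‖ ≤ s := by
    intro u hu hTu x hx
    have h1 := hbd u hu x hx
    have h2 := hbd (-u) (by rwa [norm_neg]) x hx
    have e1 : (fun i => L i u) = 0 := by funext i; rw [hT i]; exact hTu i
    have e2 : (fun i => L i (-u)) = 0 := by funext i; rw [hT i, map_neg, hTu i]; simp
    rw [e1, ← hev] at h1
    rw [e2, ← hev, map_neg] at h2
    have h3 : (2:ℂ) * ev x u = (ev x u - φ 0 x) - (- ev x u - φ 0 x) := by ring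
    have h4 : ‖(2:ℂ) * ev x u‖ ≤ s + s := by
      rw [h3]; exact (norm_sub_le _ _).trans (add_le_add h1 h2)
    rw [norm_mul] at h4
    simp at h4
    linarith
  have hker : ∀ u : Coef d, (∀ i, T i u = 0) → ∀ x ∈ cube d, ‖ev x u‖ ≤ s * ‖u‖ := by
    intro u hTu x hx
    by_cases hu : u = 0
    · simp [hu]
    have hn : 0 < ‖u‖ := norm_pos_iff.mpr hu
    have h1 := hker1 (((‖u‖⁻¹ : ℝ) : ℂ) • u) (by
      rw [norm_smul, Complex.norm_real, norm_inv, norm_norm, inv_mul_cancel₀ hn.ne'])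
      (fun i => by rw [map_smul, hTu i, smul_zero]) x hx
    rw [map_smul, norm_smul, Complex.norm_real, norm_inv, norm_norm, inv_mul_le_iff₀ hn] at h1
    linarith
  -- the kernel
  let F : EuclideanSpace ℂ B →ₗ[ℂ] (Fin n → ℂ) :=
    LinearMap.pi fun i => (T i : Coef d →ₗ[ℂ] ℂ).comp (emb B)
  let W := LinearMap.ker F
  have hdim : (B.card : ℝ) ≤ Module.finrank ℂ W + n := by
    have h1 := LinearMap.finrank_range_add_finrank_ker F
    have h2 : Module.finrank ℂ (LinearMap.range F) ≤ n := by
      have := Submodule.finrank_le (LinearMap.range F)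
      simpa using this
    have h3 : Module.finrank ℂ (EuclideanSpace ℂ B) = B.card := by simp
    rw [h3] at h1
    have : B.card ≤ Module.finrank ℂ W + n := by
      change _ + Module.finrank ℂ W = _ at h1
      omega
    exact_mod_cast this
  let b := stdOrthonormalBasis ℂ W
  have hbo : Orthonormal ℂ (fun l => (b l : EuclideanSpace ℂ B)) :=
    b.orthonormal.comp_linearIsometry W.subtypeₗᵢ
  have hTb : ∀ v : W, ∀ i, T i (emb B (v : EuclideanSpace ℂ B)) = 0 := by
    intro v i
    have := LinearMap.mem_ker.mp v.2
    exact congrFun this i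
  let f := fun l x => ev x (emb B (b l : EuclideanSpace ℂ B))
  have hG : ∀ x ∈ cube d, ∑ l, ‖f l x‖ ^ 2 ≤ s ^ 2 := by
    intro x hx
    let v : W := ∑ l, (starRingEnd ℂ (f l x)) • b l
    have h1 := hker (emb B (v : EuclideanSpace ℂ B)) (hTb v) x hx
    rw [norm_emb] at h1
    have h2 : ev x (emb B (v : EuclideanSpace ℂ B)) = ((∑ l, ‖f l x‖ ^ 2 : ℝ) : ℂ) := by
      simp only [v, Submodule.coe_sum, Submodule.coe_smul, map_sum, map_smul, smul_eq_mul]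
      push_cast
      refine Finset.sum_congr rfl fun l _ => ?_
      rw [← Complex.conj_mul']
    have h3 : ‖(v : EuclideanSpace ℂ B)‖ ^ 2 = ∑ l, ‖f l x‖ ^ 2 := by
      change ‖v‖ ^ 2 = _
      rw [← b.sum_sq_norm_inner_right v]
      refine Finset.sum_congr rfl fun l _ => ?_
      rw [b.orthonormal.inner_right_fintype, RCLike.norm_conj]
    rw [h2, Complex.norm_real, Real.norm_of_nonneg (by positivity), ← h3] at h1
    rw [← h3]
    have h4 := norm_nonneg (v : EuclideanSpace ℂ B)
    rcases h4.eq_or_lt with h5 | h5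
    · rw [← h5]; nlinarith [sq_nonneg s]
    · have : ‖(v : EuclideanSpace ℂ B)‖ ≤ s := by nlinarith
      gcongr
  -- diagonal
  let σ : (Fin d → ℤ) → ℝ := fun k => ∑ l, ‖emb B (b l : EuclideanSpace ℂ B) k‖ ^ 2
  have hσ0 : ∀ k, 0 ≤ σ k := fun k => by positivity
  have hσ1 : ∀ k, σ k ≤ 1 := by
    intro k
    by_cases hk : k ∈ B
    · have h1 := hbo.sum_inner_products_le (EuclideanSpace.single (⟨k, hk⟩ : B) (1:ℂ))
        (s := Finset.univ)
      simpa [σ, emb_apply, hk, EuclideanSpace.inner_single_right] using h1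
    · simp [σ, emb_apply, hk]
  have hσsum : ∑ k ∈ B, σ k = Module.finrank ℂ W := by
    simp only [σ]
    rw [Finset.sum_comm]
    have : ∀ l, ∑ k ∈ B, ‖emb B (b l : EuclideanSpace ℂ B) k‖ ^ 2 = 1 := by
      intro l
      have h1 := (coef_hasSum (emb B (b l : EuclideanSpace ℂ B))).tsum_eq
      rw [tsum_eq_sum (s := B) (by intro k hk; simp [emb_apply, hk]), norm_emb] at h1
      rw [h1, hbo.1 l]; norm_num
    simp [this]
  have hQ' := hQ (fun k => 1 - σ k) (fun k => ⟨by linarith [hσ1 k], by linarith [hσ0 k]⟩) (by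
    rw [Finset.sum_sub_distrib, hσsum]; simp; linarith)
  obtain ⟨p, x, c, hp, hx, hinj, horth⟩ := exists_lattice' B
  have hp0 : (0:ℝ) < p := by exact_mod_cast hp.pos
  have hav : ∑ i, ∑ l, ‖f l (x i)‖ ^ 2 = p * ∑ k ∈ B, (ω k)⁻¹ ^ 2 * σ k := by
    rw [Finset.sum_comm]
    have : ∀ l, ∑ i, ‖f l (x i)‖ ^ 2 =
        p * ∑ k ∈ B, (ω k)⁻¹ ^ 2 * ‖emb B (b l : EuclideanSpace ℂ B) k‖ ^ 2 := by
      intro l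
      have h1 := parseval B x c hinj horth
        (fun k => ((ω k : ℂ))⁻¹ * emb B (b l : EuclideanSpace ℂ B) k)
      simp only [f, hev, torus_emb]
      rw [h1]
      congr 1
      refine Finset.sum_congr rfl fun k _ => ?_
      rw [norm_mul, norm_inv, Complex.norm_real, Real.norm_of_nonneg (hω k).le, mul_pow]
    simp only [this]
    rw [← Finset.mul_sum, Finset.sum_comm]
    congr 1
    refine Finset.sum_congr rfl fun k _ => ?_
    rw [Finset.mul_sum]
  have hle : ∑ i, ∑ l, ‖f l (x i)‖ ^ 2 ≤ p * s ^ 2 := by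
    refine (Finset.sum_le_sum fun i _ => hG (x i) (hx i)).trans ?_
    simp
  rw [hav] at hle
  have hfin := le_of_mul_le_mul_left hle hp0
  have : Q ≤ s ^ 2 := by
    refine hQ'.trans (le_trans (le_of_eq ?_) hfin)
    refine Finset.sum_congr rfl fun k _ => ?_
    ring
  exact Real.sqrt_le_iff.mpr ⟨hs0, this⟩

/-- The squared inverse weight. -/
def rho (w : ℝ) (a b : ℕ → ℝ) (d : ℕ) (h : Fin d → ℤ) : ℝ :=
  w ^ (∑ j : Fin d, a (j.1 + 1) * (|h j| : ℝ) ^ b (j.1 + 1))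

lemma wt_pos {w : ℝ} (hw : w ∈ Set.Ioo (0:ℝ) 1) (a b : ℕ → ℝ) (d : ℕ) (h : Fin d → ℤ) :
    0 < expKorWeight w a b d h := Real.rpow_pos_of_pos hw.1 _

lemma wt_rho {w : ℝ} (hw : w ∈ Set.Ioo (0:ℝ) 1) (a b : ℕ → ℝ) (d : ℕ) (h : Fin d → ℤ) :
    (expKorWeight w a b d h)⁻¹ ^ 2 = rho w a b d h := by
  unfold expKorWeight rho
  rw [← Real.rpow_neg hw.1.le, ← Real.rpow_natCast, ← Real.rpow_mul hw.1.le]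
  congr 1; push_cast; ring

lemma rho_pos {w : ℝ} (hw : w ∈ Set.Ioo (0:ℝ) 1) (a b : ℕ → ℝ) (d : ℕ) (h : Fin d → ℤ) :
    0 < rho w a b d h := Real.rpow_pos_of_pos hw.1 _

lemma a_ge {a : ℕ → ℝ} (hamono : ∀ j, 1 ≤ j → a j ≤ a (j + 1)) {i j : ℕ} (hi : 1 ≤ i)
    (hij : i ≤ j) : a i ≤ a j := by
  induction j, hij using Nat.le_induction with
  | base => exact le_rfl
  | succ n hn ih => exact ih.trans (hamono n (hi.trans hn))

lemma rho_le_one {w : ℝ} (hw : w ∈ Set.Ioo (0:ℝ) 1) {a : ℕ → ℝ} (b : ℕ → ℝ)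
    (ha : ∀ j, 1 ≤ j → 0 < a j) (d : ℕ) (h : Fin d → ℤ) : rho w a b d h ≤ 1 := by
  apply Real.rpow_le_one hw.1.le hw.2.le
  refine Finset.sum_nonneg fun j _ => mul_nonneg (ha _ (by omega)).le ?_
  positivity

lemma rho_zero {w : ℝ} (a b : ℕ → ℝ) (hb : ∀ j, 1 ≤ j → 0 < b j) (d : ℕ) :
    rho w a b d 0 = 1 := by
  unfold rho
  rw [Finset.sum_eq_zero, Real.rpow_zero]
  intro j _
  have := hb (j.1 + 1) (by omega)
  simp [Real.zero_rpow this.ne']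

lemma rho_update {w : ℝ} (hw : w ∈ Set.Ioo (0:ℝ) 1) {a b : ℕ → ℝ}
    (ha : ∀ j, 1 ≤ j → 0 < a j) (hb : ∀ j, 1 ≤ j → 0 < b j) (d : ℕ) (h : Fin d → ℤ)
    (j : Fin d) (i : ℤ) (hi : |i| ≤ |h j|) :
    rho w a b d h ≤ rho w a b d (Function.update h j i) := by
  unfold rho
  apply Real.rpow_le_rpow_of_exponent_ge hw.1 hw.2.le
  refine Finset.sum_le_sum fun l _ => ?_
  have h1 := (ha (l.1 + 1) (by omega)).le
  have h2 := (hb (l.1 + 1) (by omega)).le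
  refine mul_le_mul_of_nonneg_left (Real.rpow_le_rpow (abs_nonneg _) ?_ h2) h1
  by_cases hl : l = j
  · subst hl
    rw [Function.update_self]
    exact_mod_cast hi
  · rw [Function.update_of_ne hl]

lemma summable_stretch {l c : ℝ} (hl : 0 < l) (hc : 0 < c) :
    Summable (fun n : ℕ => Real.exp (-l * (n : ℝ) ^ c)) := by
  have h1 := isLittleO_exp_neg_mul_rpow_atTop hl (-(2 / c))
  have ht : Tendsto (fun n : ℕ => (n : ℝ) ^ c) atTop atTop :=
    (tendsto_rpow_atTop hc).comp tendsto_natCast_atTop_atTop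
  have h2 := (h1.comp_tendsto ht).isBigO
  have h3 : Summable (fun n : ℕ => (n : ℝ) ^ (-2 : ℝ)) := by
    rw [Real.summable_nat_rpow]; norm_num
  refine summable_of_isBigO_nat h3 ?_
  refine h2.congr (fun n => rfl) (fun n => ?_)
  simp only [Function.comp]
  rw [← Real.rpow_mul (Nat.cast_nonneg n)]
  congr 1
  field_simp

lemma sum_bound {w : ℝ} (hw : w ∈ Set.Ioo (0:ℝ) 1) {a b : ℕ → ℝ} {c : ℝ} (hc : 0 < c)
    (hapos : 0 < a 1) (hamono : ∀ j, 1 ≤ j → a j ≤ a (j + 1))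
    (hb : ∀ j, 1 ≤ j → c ≤ b j) {τ : ℝ} (hτ : 0 < τ) :
    ∃ C : ℝ, 0 ≤ C ∧ ∀ d (F : Finset (Fin d → ℤ)), ∑ h ∈ F, rho w a b d h ^ τ ≤
      Real.exp (C * ∑ j ∈ Finset.range d, w ^ (τ * a (j + 1))) := by
  classical
  have hlw : 0 < -Real.log w := by
    have := Real.log_neg hw.1 hw.2; linarith
  set g : ℤ → ℝ := fun h => w ^ (τ * a 1 * ((|h| : ℝ) ^ c - 1)) with hg
  have hg0 : ∀ h, 0 ≤ g h := fun h => (Real.rpow_pos_of_pos hw.1 _).le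
  have hgs : Summable g := by
    have hn : Summable (fun n : ℕ => g (n : ℤ)) := by
      have h1 := (summable_stretch (l := -Real.log w * (τ * a 1)) (c := c) (by positivity) hc).mul_left
        (Real.exp (-Real.log w * (τ * a 1)))
      refine h1.congr fun n => ?_
      simp only [hg]
      rw [← Real.exp_add, Real.rpow_def_of_pos hw.1]
      congr 1
      simp
      ring
    refine Summable.of_nat_of_neg hn ?_
    refine hn.congr fun n => ?_
    simp [hg]
  have ha : ∀ j, 1 ≤ j → a 1 ≤ a j := fun j hj => a_ge hamono le_rfl hj
  refine ⟨∑' h, g h, tsum_nonneg hg0, fun d F => ?_⟩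
  -- one-dimensional estimate
  have hone : ∀ j, 1 ≤ j → ∀ E : Finset ℤ, ∑ h ∈ E, (w ^ (a j * (|h| : ℝ) ^ b j)) ^ τ ≤
      Real.exp ((∑' h, g h) * w ^ (τ * a j)) := by
    intro j hj E
    have haj := ha j hj
    have hbj := hb j hj
    have hterm : ∀ h : ℤ, (w ^ (a j * (|h| : ℝ) ^ b j)) ^ τ ≤
        (if h = 0 then 1 else 0) + g h * w ^ (τ * a j) := by
      intro h
      rw [← Real.rpow_mul hw.1.le]
      by_cases h0 : h = 0
      · subst h0
        have : b j ≠ 0 := by linarith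
        simp [Real.zero_rpow this]
        exact mul_nonneg (hg0 _) (Real.rpow_pos_of_pos hw.1 _).le
      · rw [if_neg h0, zero_add]
        simp only [hg]
        rw [← Real.rpow_add hw.1]
        apply Real.rpow_le_rpow_of_exponent_ge hw.1 hw.2.le
        have h1 : (1:ℝ) ≤ |(h:ℝ)| := by
          exact_mod_cast Int.one_le_abs h0
        have h2 : |(h:ℝ)| ^ c ≤ |(h:ℝ)| ^ b j := Real.rpow_le_rpow_of_exponent_le h1 hbj
        have h3 : 1 ≤ |(h:ℝ)| ^ c := Real.one_le_rpow h1 hc.le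
        have h4 : a 1 * (|(h:ℝ)| ^ c - 1) ≤ a j * (|(h:ℝ)| ^ b j - 1) :=
          mul_le_mul haj (by linarith) (by linarith) (by linarith)
        nlinarith
    calc _ ≤ ∑ h ∈ E, ((if h = 0 then 1 else 0) + g h * w ^ (τ * a j)) :=
          Finset.sum_le_sum fun h _ => hterm h
      _ ≤ 1 + (∑' h, g h) * w ^ (τ * a j) := by
          rw [Finset.sum_add_distrib, ← Finset.sum_mul]
          refine add_le_add ?_ (mul_le_mul_of_nonneg_right (hgs.sum_le_tsum E (fun i _ => hg0 i))
            (Real.rpow_pos_of_pos hw.1 _).le)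
          rw [Finset.sum_ite_eq']
          split_ifs <;> norm_num
      _ ≤ _ := by rw [add_comm]; exact Real.add_one_le_exp _
  have hprod : ∀ h : Fin d → ℤ, rho w a b d h ^ τ =
      ∏ j : Fin d, (w ^ (a (j.1+1) * (|h j| : ℝ) ^ b (j.1+1))) ^ τ := by
    intro h
    unfold rho
    rw [Real.rpow_sum_of_pos hw.1, Real.finsetProd_rpow]
    intro i _; exact (Real.rpow_pos_of_pos hw.1 _).le
  have hsub : F ⊆ Fintype.piFinset (fun j => F.image (fun h => h j)) := by
    intro h hh
    rw [Fintype.mem_piFinset]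
    intro j
    exact Finset.mem_image_of_mem _ hh
  calc ∑ h ∈ F, rho w a b d h ^ τ
      ≤ ∑ h ∈ Fintype.piFinset (fun j => F.image (fun h => h j)), rho w a b d h ^ τ :=
        Finset.sum_le_sum_of_subset_of_nonneg hsub
          (fun h _ _ => (Real.rpow_pos_of_pos (rho_pos hw a b d h) _).le)
    _ = ∏ j : Fin d, ∑ i ∈ F.image (fun h => h j), (w ^ (a (j.1+1) * (|i| : ℝ) ^ b (j.1+1))) ^ τ := by
        rw [Finset.prod_univ_sum]
        exact Finset.sum_congr rfl fun h _ => hprod h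
    _ ≤ ∏ j : Fin d, Real.exp ((∑' h, g h) * w ^ (τ * a (j.1+1))) := by
        refine Finset.prod_le_prod (fun j _ => Finset.sum_nonneg fun i _ => ?_)
          (fun j _ => hone _ (by omega) _)
        exact Real.rpow_nonneg (Real.rpow_nonneg hw.1.le _) _
    _ = _ := by
        rw [← Real.exp_sum, ← Finset.mul_sum,
          Finset.sum_range (fun j => w ^ (τ * a (j + 1)))]

lemma rho_summable {w : ℝ} (hw : w ∈ Set.Ioo (0:ℝ) 1) {a b : ℕ → ℝ} {c : ℝ} (hc : 0 < c)
    (hapos : 0 < a 1) (hamono : ∀ j, 1 ≤ j → a j ≤ a (j + 1))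
    (hb : ∀ j, 1 ≤ j → c ≤ b j) {τ : ℝ} (hτ : 0 < τ) (d : ℕ) :
    Summable (fun h => rho w a b d h ^ τ) := by
  obtain ⟨C, -, hC⟩ := sum_bound hw hc hapos hamono hb hτ
  exact summable_of_sum_le (fun h => (Real.rpow_pos_of_pos (rho_pos hw a b d h) _).le) (hC d)

lemma wt_summable {w : ℝ} (hw : w ∈ Set.Ioo (0:ℝ) 1) {a b : ℕ → ℝ} {c : ℝ} (hc : 0 < c)
    (hapos : 0 < a 1) (hamono : ∀ j, 1 ≤ j → a j ≤ a (j + 1))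
    (hb : ∀ j, 1 ≤ j → c ≤ b j) (d : ℕ) :
    Summable (fun h => (expKorWeight w a b d h)⁻¹ ^ 2) := by
  have := rho_summable hw hc hapos hamono hb one_pos d
  simpa [wt_rho hw] using this

lemma upper {w : ℝ} (hw : w ∈ Set.Ioo (0:ℝ) 1) {a b : ℕ → ℝ} {c : ℝ} (hc : 0 < c)
    (hapos : 0 < a 1) (hamono : ∀ j, 1 ≤ j → a j ≤ a (j + 1))
    (hb : ∀ j, 1 ≤ j → c ≤ b j) {τ : ℝ} (hτ : 0 < τ) (hτ1 : τ < 1) (d : ℕ) (M : ℝ) (hM1 : 1 ≤ M)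
    (hM : ∀ F : Finset (Fin d → ℤ), ∑ h ∈ F, rho w a b d h ^ τ ≤ M) (ε : ℝ) (hε : 0 < ε)
    (hε1 : ε < 1) :
    ∃ n : ℕ, (n : ℝ) ≤ 2 * (M * ((ε ^ 2 / (4 * M)) ^ (1 / (1 - τ))) ^ (-τ)) ^ 2 ∧
      wcErr (expKorWeight w a b d) (stdInfo (expKorWeight w a b d)) n ≤ ENNReal.ofReal ε := by
  classical
  have ha : ∀ j, 1 ≤ j → 0 < a j := fun j hj => hapos.trans_le (a_ge hamono le_rfl hj)
  have hb' : ∀ j, 1 ≤ j → 0 < b j := fun j hj => hc.trans_le (hb j hj)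
  have hM0 : 0 < M := by linarith
  set T := (ε ^ 2 / (4 * M)) ^ (1 / (1 - τ)) with hT
  have hτ' : 0 < 1 - τ := by linarith
  have hq0 : 0 < ε ^ 2 / (4 * M) := by positivity
  have hT0 : 0 < T := Real.rpow_pos_of_pos hq0 _
  have hT1 : T ≤ 1 := by
    apply Real.rpow_le_one hq0.le _ (by positivity)
    rw [div_le_one (by positivity)]
    nlinarith
  have hTpow : T ^ (1 - τ) = ε ^ 2 / (4 * M) := by
    rw [hT, ← Real.rpow_mul hq0.le, one_div, inv_mul_cancel₀ hτ'.ne', Real.rpow_one]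
  have hfin : {h : Fin d → ℤ | T ≤ rho w a b d h}.Finite := by
    have h1 := (rho_summable hw hc hapos hamono hb hτ d).tendsto_cofinite_zero
    have h2 := h1.eventually (gt_mem_nhds (Real.rpow_pos_of_pos hT0 τ))
    rw [Filter.eventually_cofinite] at h2
    refine h2.subset fun h hh => ?_
    simp only [Set.mem_ofPred_eq, not_lt] at hh ⊢
    exact Real.rpow_le_rpow hT0.le hh hτ.le
  set A := hfin.toFinset with hA
  have hmem : ∀ h, h ∈ A ↔ T ≤ rho w a b d h := by intro h; simp [hA]
  have h0A : (0 : Fin d → ℤ) ∈ A := by rw [hmem, rho_zero a b hb']; exact hT1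
  have hcard0 : 0 < A.card := Finset.card_pos.mpr ⟨0, h0A⟩
  have hcard : (A.card : ℝ) ≤ M * T ^ (-τ) := by
    have h1 : (A.card : ℝ) * T ^ τ ≤ M := by
      refine le_trans ?_ (hM A)
      rw [← nsmul_eq_mul]
      refine Finset.card_nsmul_le_sum _ _ _ fun h hh => ?_
      exact Real.rpow_le_rpow hT0.le ((hmem h).mp hh) hτ.le
    rw [Real.rpow_neg hT0.le, ← div_eq_mul_inv, le_div_iff₀ (Real.rpow_pos_of_pos hT0 _)]
    exact h1
  obtain ⟨p, hp, hp1, hp2⟩ := Nat.exists_prime_lt_and_le_two_mul (A.card ^ 2) (by positivity)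
  have hcoord : ∀ h ∈ A, ∀ j, 2 * |h j| + 1 ≤ A.card := by
    intro h hh j
    have h1 : (Finset.Icc (-|h j|) |h j|).card ≤ A.card := by
      apply Finset.card_le_card_of_injOn (fun i => Function.update h j i)
      · intro i hi
        rw [Finset.mem_coe, Finset.mem_Icc] at hi
        rw [Finset.mem_coe, hmem]
        exact ((hmem h).mp hh).trans (rho_update hw ha hb' d h j i (abs_le.mpr hi))
      · intro i _ i' _ he
        have := congrFun he j
        simpa using this
    rw [Int.card_Icc] at h1
    have := abs_nonneg (h j)
    omega
  refine ⟨p, ?_, ?_⟩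
  · have h1 : (p : ℝ) ≤ 2 * (A.card : ℝ) ^ 2 := by exact_mod_cast hp2
    refine h1.trans ?_
    gcongr
  · have h1 := wcErr_std_le hp (expKorWeight w a b d) (wt_pos hw a b d)
      (wt_summable hw hc hapos hamono hb d) A hp1 (by
        intro h hh k hk j
        have e1 := hcoord h hh j
        have e2 := hcoord k hk j
        have e3 := abs_sub (h j) (k j)
        have e4 : A.card ≤ A.card ^ 2 := Nat.le_self_pow (by norm_num) _
        omega) (ε ^ 2 / 4) (by
        intro F hF
        have : ∀ h ∈ F, (expKorWeight w a b d h)⁻¹ ^ 2 ≤ rho w a b d h ^ τ * T ^ (1 - τ) := by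
          intro h hh
          rw [wt_rho hw]
          have hn : h ∉ A := Finset.disjoint_left.mp hF hh
          rw [hmem, not_le] at hn
          have hr := rho_pos hw a b d h
          calc rho w a b d h = rho w a b d h ^ τ * rho w a b d h ^ (1 - τ) := by
                rw [← Real.rpow_add hr]; simp
            _ ≤ _ := mul_le_mul_of_nonneg_left (Real.rpow_le_rpow hr.le hn.le hτ'.le)
                (Real.rpow_pos_of_pos hr _).le
        refine (Finset.sum_le_sum this).trans ?_
        rw [← Finset.sum_mul, hTpow]
        refine (mul_le_mul_of_nonneg_right (hM F) hq0.le).trans (le_of_eq ?_)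
        field_simp)
    refine h1.trans (ENNReal.ofReal_le_ofReal (le_of_eq ?_))
    rw [show ε ^ 2 / 4 = (ε / 2) ^ 2 by ring, Real.sqrt_sq (by positivity)]
    ring

lemma lower_sum {w : ℝ} (hw : w ∈ Set.Ioo (0:ℝ) 1) {a b : ℕ → ℝ} {c : ℝ} (hc : 0 < c)
    (hapos : 0 < a 1) (hamono : ∀ j, 1 ≤ j → a j ≤ a (j + 1))
    (hb : ∀ j, 1 ≤ j → c ≤ b j) (d n : ℕ) (B : Finset (Fin d → ℤ)) :
    ENNReal.ofReal (Real.sqrt (∑ k ∈ B, rho w a b d k - n)) ≤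
      wcErr (expKorWeight w a b d) (allInfo d) n := by
  have ha : ∀ j, 1 ≤ j → 0 < a j := fun j hj => hapos.trans_le (a_ge hamono le_rfl hj)
  refine lower _ (wt_pos hw a b d) (wt_summable hw hc hapos hamono hb d) n B _ ?_
  intro m hm hmn
  simp only [wt_rho hw, mul_sub, mul_one, Finset.sum_sub_distrib]
  have : ∑ k ∈ B, rho w a b d k * m k ≤ ∑ k ∈ B, m k :=
    Finset.sum_le_sum fun k _ =>
      mul_le_of_le_one_left (hm k).1 (rho_le_one hw b ha d k)
  linarith

lemma lower_card {w : ℝ} (hw : w ∈ Set.Ioo (0:ℝ) 1) {a b : ℕ → ℝ} {c : ℝ} (hc : 0 < c)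
    (hapos : 0 < a 1) (hamono : ∀ j, 1 ≤ j → a j ≤ a (j + 1))
    (hb : ∀ j, 1 ≤ j → c ≤ b j) (d n : ℕ) (B : Finset (Fin d → ℤ)) (t : ℝ) (ht0 : 0 ≤ t)
    (ht : ∀ k ∈ B, t ≤ rho w a b d k) :
    ENNReal.ofReal (Real.sqrt (t * (B.card - n))) ≤
      wcErr (expKorWeight w a b d) (allInfo d) n := by
  refine lower _ (wt_pos hw a b d) (wt_summable hw hc hapos hamono hb d) n B _ ?_
  intro m hm hmn
  simp only [wt_rho hw]
  have h1 : ∑ k ∈ B, t * (1 - m k) ≤ ∑ k ∈ B, rho w a b d k * (1 - m k) :=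
    Finset.sum_le_sum fun k hk =>
      mul_le_mul_of_nonneg_right (ht k hk) (by linarith [(hm k).2])
  refine le_trans ?_ h1
  rw [← Finset.mul_sum, Finset.sum_sub_distrib]
  refine mul_le_mul_of_nonneg_left ?_ ht0
  simp
  linarith

lemma one_le_init {w : ℝ} (hw : w ∈ Set.Ioo (0:ℝ) 1) {a b : ℕ → ℝ} {c : ℝ} (hc : 0 < c)
    (hapos : 0 < a 1) (hamono : ∀ j, 1 ≤ j → a j ≤ a (j + 1))
    (hb : ∀ j, 1 ≤ j → c ≤ b j) (d : ℕ) : 1 ≤ initErr (expKorWeight w a b d) := by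
  have h1 := lower_sum hw hc hapos hamono hb d 0 {0}
  rw [Finset.sum_singleton, rho_zero a b (fun j hj => hc.trans_le (hb j hj))] at h1
  simp only [CharP.cast_eq_zero, sub_zero, Real.sqrt_one, ENNReal.ofReal_one] at h1
  refine h1.trans ?_
  unfold wcErr initErr
  refine iInf_le_of_le (fun i => i.elim0) (iInf_le_of_le (fun i => i.elim0)
    (iInf_le_of_le (fun _ _ => 0) ?_))
  simp

lemma one_le_CRI {w : ℝ} (hw : w ∈ Set.Ioo (0:ℝ) 1) {a b : ℕ → ℝ} {c : ℝ} (hc : 0 < c)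
    (hapos : 0 < a 1) (hamono : ∀ j, 1 ≤ j → a j ≤ a (j + 1))
    (hb : ∀ j, 1 ≤ j → c ≤ b j) (d : ℕ) (crit : Crit) : 1 ≤ CRI (expKorWeight w a b d) crit := by
  cases crit
  · exact le_rfl
  · exact one_le_init hw hc hapos hamono hb d

lemma nc_good {w : ℝ} (hw : w ∈ Set.Ioo (0:ℝ) 1) {a b : ℕ → ℝ} {c : ℝ} (hc : 0 < c)
    (hapos : 0 < a 1) (hamono : ∀ j, 1 ≤ j → a j ≤ a (j + 1))
    (hb : ∀ j, 1 ≤ j → c ≤ b j) (d : ℕ) (crit : Crit) (useStd : Bool) (ε : ℝ) (n : ℕ)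
    (h : wcErr (expKorWeight w a b d) (stdInfo (expKorWeight w a b d)) n ≤ ENNReal.ofReal ε) :
    wcErr (expKorWeight w a b d)
      (if useStd then stdInfo (expKorWeight w a b d) else allInfo d) n ≤
      ENNReal.ofReal ε * CRI (expKorWeight w a b d) crit := by
  have h1 : ENNReal.ofReal ε ≤ ENNReal.ofReal ε * CRI (expKorWeight w a b d) crit :=
    le_mul_of_one_le_right zero_le (one_le_CRI hw hc hapos hamono hb d crit)
  refine le_trans ?_ (h.trans h1)
  cases useStd
  · exact wcErr_mono _ _ _ (std_subset _ (wt_pos hw a b d) (wt_summable hw hc hapos hamono hb d)) n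
  · exact le_rfl

lemma nc_le {w : ℝ} (hw : w ∈ Set.Ioo (0:ℝ) 1) {a b : ℕ → ℝ} {c : ℝ} (hc : 0 < c)
    (hapos : 0 < a 1) (hamono : ∀ j, 1 ≤ j → a j ≤ a (j + 1))
    (hb : ∀ j, 1 ≤ j → c ≤ b j) (d : ℕ) (crit : Crit) (useStd : Bool) (ε : ℝ) (n : ℕ)
    (h : wcErr (expKorWeight w a b d) (stdInfo (expKorWeight w a b d)) n ≤ ENNReal.ofReal ε) :
    expKorNC w a b useStd crit d ε ≤ n :=
  Nat.sInf_le (nc_good hw hc hapos hamono hb d crit useStd ε n h)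

lemma nc_spec {w : ℝ} (hw : w ∈ Set.Ioo (0:ℝ) 1) {a b : ℕ → ℝ} {c : ℝ} (hc : 0 < c)
    (hapos : 0 < a 1) (hamono : ∀ j, 1 ≤ j → a j ≤ a (j + 1))
    (hb : ∀ j, 1 ≤ j → c ≤ b j) (d : ℕ) (crit : Crit) (useStd : Bool) (ε : ℝ) (hε : 0 < ε)
    (hε1 : ε < 1) :
    wcErr (expKorWeight w a b d) (allInfo d) (expKorNC w a b useStd crit d ε) ≤
      ENNReal.ofReal ε * CRI (expKorWeight w a b d) crit := by
  have hne : {n : ℕ | wcErr (expKorWeight w a b d)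
      (if useStd then stdInfo (expKorWeight w a b d) else allInfo d) n ≤
      ENNReal.ofReal ε * CRI (expKorWeight w a b d) crit}.Nonempty := by
    obtain ⟨C, hC0, hC⟩ := sum_bound hw hc hapos hamono hb (τ := 1 / 2) (by norm_num)
    obtain ⟨n, -, hn⟩ := upper hw hc hapos hamono hb (τ := 1 / 2) (by norm_num) (by norm_num) d _
      (Real.one_le_exp (mul_nonneg hC0
        (Finset.sum_nonneg fun j _ => (Real.rpow_pos_of_pos hw.1 _).le))) (hC d) ε hε hε1
    exact ⟨n, nc_good hw hc hapos hamono hb d crit useStd ε n hn⟩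
  have h1 := Nat.sInf_mem hne
  refine le_trans ?_ h1
  change wcErr _ _ (sInf _) ≤ _
  cases useStd
  · exact le_rfl
  · exact wcErr_mono _ _ _ (std_subset _ (wt_pos hw a b d) (wt_summable hw hc hapos hamono hb d)) _

lemma cond_spt {w : ℝ} (hw : w ∈ Set.Ioo (0:ℝ) 1) {a b : ℕ → ℝ} {c : ℝ} (hc : 0 < c)
    (hapos : 0 < a 1) (hamono : ∀ j, 1 ≤ j → a j ≤ a (j + 1))
    (hb : ∀ j, 1 ≤ j → c ≤ b j) (crit : Crit) (useStd : Bool)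
    (h : ((1 / Real.log w⁻¹ : ℝ) : EReal) <
        Filter.liminf (fun j : ℕ => ((a j / Real.log j : ℝ) : EReal)) Filter.atTop) :
    ALGSPT (expKorNC w a b useStd crit) := by
  have hlw : 0 < Real.log w⁻¹ := Real.log_pos ((one_lt_inv₀ hw.1).mpr hw.2)
  obtain ⟨s', hs1, hs2⟩ := EReal.lt_iff_exists_real_btwn.mp h
  have hs1 : 1 / Real.log w⁻¹ < s' := by exact_mod_cast hs1
  have hev := Filter.eventually_lt_of_lt_liminf hs2
  set s := s' * Real.log w⁻¹ with hs
  have hs1 : 1 < s := by rwa [div_lt_iff₀ hlw] at hs1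
  set τ := (s + 1) / (2 * s) with hτ
  have hτ0 : 0 < τ := by positivity
  have hτ1 : τ < 1 := by rw [hτ, div_lt_one (by positivity)]; linarith
  have hτs : τ * s = (s + 1) / 2 := by rw [hτ]; field_simp
  have hsum : Summable (fun j : ℕ => w ^ (τ * a (j + 1))) := by
    have h1 : Summable (fun j : ℕ => w ^ (τ * a j)) := by
      have h3 : Summable (fun n : ℕ => (n : ℝ) ^ (-((s + 1) / 2))) := by
        rw [Real.summable_nat_rpow]; linarith
      refine summable_of_isBigO_nat h3 (Asymptotics.IsBigO.of_bound 1 ?_)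
      filter_upwards [hev, eventually_ge_atTop 2] with j hj hj2
      have hj : s' < a j / Real.log j := by exact_mod_cast hj
      have hj0 : (1:ℝ) < j := by exact_mod_cast hj2
      have hlj : 0 < Real.log j := Real.log_pos hj0
      rw [lt_div_iff₀ hlj] at hj
      rw [one_mul, Real.norm_of_nonneg (Real.rpow_nonneg hw.1.le _),
        Real.norm_of_nonneg (by positivity), Real.rpow_def_of_pos hw.1,
        Real.rpow_def_of_pos (by linarith), Real.exp_le_exp, ← hτs]
      have e : Real.log w = - Real.log w⁻¹ := by rw [Real.log_inv]; ring
      rw [e]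
      have : τ * Real.log w⁻¹ * (s' * Real.log j) ≤ τ * Real.log w⁻¹ * a j :=
        mul_le_mul_of_nonneg_left hj.le (by positivity)
      rw [hs]; nlinarith
    exact (summable_nat_add_iff 1).mpr h1
  obtain ⟨C, hC0, hC⟩ := sum_bound hw hc hapos hamono hb hτ0
  have hnn : ∀ j : ℕ, 0 ≤ w ^ (τ * a (j + 1)) := fun j => (Real.rpow_pos_of_pos hw.1 _).le
  set M := Real.exp (C * ∑' j : ℕ, w ^ (τ * a (j + 1))) with hM
  have hM1 : 1 ≤ M := Real.one_le_exp (mul_nonneg hC0 (tsum_nonneg hnn))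
  have hM0 : 0 < M := by linarith
  have hτ' : 0 < 1 - τ := by linarith
  refine ⟨2 * (M * ((1 / (4 * M)) ^ (1 / (1 - τ))) ^ (-τ)) ^ 2, by positivity,
    4 * τ / (1 - τ), by positivity, fun d hd ε hε => ?_⟩
  obtain ⟨n, hn, hn2⟩ := upper hw hc hapos hamono hb hτ0 hτ1 d M hM1 (fun F => (hC d F).trans (by
    rw [hM, Real.exp_le_exp]
    exact mul_le_mul_of_nonneg_left (hsum.sum_le_tsum _ fun j _ => hnn j) hC0)) ε hε.1 hε.2
  have h1 := nc_le hw hc hapos hamono hb d crit useStd ε n hn2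
  have h2 : (expKorNC w a b useStd crit d ε : ℝ) ≤ n := by exact_mod_cast h1
  refine h2.trans (hn.trans (le_of_eq ?_))
  have hε0 := hε.1
  have e1 : ε ^ 2 / (4 * M) = ε ^ 2 * (1 / (4 * M)) := by ring
  rw [e1, Real.mul_rpow (by positivity) (by positivity),
    Real.mul_rpow (by positivity) (by positivity)]
  have e2 : (((ε ^ 2) ^ (1 / (1 - τ))) ^ (-τ)) ^ 2 = ε ^ (-(4 * τ / (1 - τ))) := by
    rw [← Real.rpow_natCast, ← Real.rpow_natCast, ← Real.rpow_mul hε0.le, ← Real.rpow_mul hε0.le,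
      ← Real.rpow_mul hε0.le]
    congr 1
    push_cast
    field_simp
    norm_num
  rw [← e2]
  ring

/-- Polynomial bound in the absolute sense for general information. -/
def PBound (w : ℝ) (a b : ℕ → ℝ) (C p q : ℝ) : Prop :=
  ∀ d : ℕ, 0 < d → ∀ ε ∈ Set.Ioo (0:ℝ) 1, ∃ n : ℕ, (n : ℝ) ≤ C * (d : ℝ) ^ q * ε ^ (-p) ∧
    wcErr (expKorWeight w a b d) (allInfo d) n ≤ ENNReal.ofReal ε

lemma pt_pbound {w : ℝ} (hw : w ∈ Set.Ioo (0:ℝ) 1) {a b : ℕ → ℝ} {c : ℝ} (hc : 0 < c)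
    (hapos : 0 < a 1) (hamono : ∀ j, 1 ≤ j → a j ≤ a (j + 1))
    (hb : ∀ j, 1 ≤ j → c ≤ b j) (crit : Crit) (useStd : Bool)
    (h : ALGPT (expKorNC w a b useStd crit)) :
    ∃ C > (0:ℝ), ∃ p ≥ (0:ℝ), ∃ q ≥ (0:ℝ), PBound w a b C p q := by
  obtain ⟨C, hC, p, hp, q, hq, hn⟩ := h
  cases crit
  · refine ⟨C, hC, p, hp, q, hq, fun d hd ε hε => ⟨_, hn d hd ε hε, ?_⟩⟩
    have := nc_spec hw hc hapos hamono hb d Crit.ABS useStd ε hε.1 hε.2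
    simpa [CRI] using this
  · set D := 2 * C * (1 / 2 : ℝ) ^ (-p) with hD
    have hD0 : 0 < D := by positivity
    refine ⟨C * D ^ p, by positivity, p, hp, q + q * p, by positivity, fun d hd ε hε => ?_⟩
    have hd0 : (0:ℝ) < d := by exact_mod_cast hd
    have hs := rho_summable hw hc hapos hamono hb one_pos d
    simp only [Real.rpow_one] at hs
    set K := ∑' k, rho w a b d k with hK
    have hinit := initErr_le _ (wt_pos hw a b d) (wt_summable hw hc hapos hamono hb d)
    simp only [wt_rho hw] at hinit
    rw [← hK] at hinit
    have hK1 : 1 ≤ K := by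
      have := hs.sum_le_tsum {0} (fun i _ => (rho_pos hw a b d i).le)
      rwa [Finset.sum_singleton, rho_zero a b (fun j hj => hc.trans_le (hb j hj))] at this
    have hK0 : 0 ≤ K := by linarith
    have hKD : K ≤ D * (d : ℝ) ^ q := by
      have h1 := hn d hd (1 / 2) (by norm_num)
      have h2 := nc_spec hw hc hapos hamono hb d Crit.NOR useStd (1 / 2) (by norm_num) (by norm_num)
      set n := expKorNC w a b useStd Crit.NOR d (1 / 2)
      have h3 : ∀ B : Finset (Fin d → ℤ), ∑ k ∈ B, rho w a b d k ≤ n + K / 4 := by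
        intro B
        have h4 := (lower_sum hw hc hapos hamono hb d n B).trans h2
        have h5 : ENNReal.ofReal (1 / 2) * CRI (expKorWeight w a b d) Crit.NOR ≤
            ENNReal.ofReal (1 / 2 * Real.sqrt K) := by
          rw [ENNReal.ofReal_mul (by norm_num)]
          exact mul_le_mul_right hinit _
        have h6 := h4.trans h5
        rw [ENNReal.ofReal_le_ofReal_iff (by positivity), Real.sqrt_le_iff, mul_pow,
          Real.sq_sqrt hK0] at h6
        linarith [h6.2]
      have h4 : K ≤ n + K / 4 := hs.tsum_le_of_sum_le h3
      have h5 : K ≤ 2 * n := by linarith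
      have : D * (d : ℝ) ^ q = 2 * (C * (d : ℝ) ^ q * (1 / 2 : ℝ) ^ (-p)) := by rw [hD]; ring
      rw [this]; linarith
    set E := D * (d : ℝ) ^ q with hE
    have hE1 : 1 ≤ E := hK1.trans hKD
    have hE0 : 0 < E := by linarith
    have hε' : ε / E ∈ Set.Ioo (0:ℝ) 1 :=
      ⟨div_pos hε.1 hE0, by rw [div_lt_one hE0]; linarith [hε.2]⟩
    refine ⟨_, (hn d hd (ε / E) hε').trans (le_of_eq ?_), ?_⟩
    · rw [Real.div_rpow hε.1.le hE0.le, Real.rpow_neg hE0.le, div_inv_eq_mul, hE,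
        Real.mul_rpow hD0.le (by positivity), ← Real.rpow_mul hd0.le, Real.rpow_add hd0]
      ring
    · refine (nc_spec hw hc hapos hamono hb d Crit.NOR useStd (ε / E) hε'.1 hε'.2).trans ?_
      have h1 : CRI (expKorWeight w a b d) Crit.NOR ≤ ENNReal.ofReal E := by
        refine hinit.trans (ENNReal.ofReal_le_ofReal ?_)
        rw [Real.sqrt_le_iff]
        exact ⟨hE0.le, by nlinarith⟩
      refine (mul_le_mul_right h1 _).trans ?_
      rw [← ENNReal.ofReal_mul hε'.1.le, div_mul_cancel₀ _ hE0.ne']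

lemma pbound_ev {w : ℝ} (hw : w ∈ Set.Ioo (0:ℝ) 1) {a b : ℕ → ℝ} {c : ℝ} (hc : 0 < c)
    (hapos : 0 < a 1) (hamono : ∀ j, 1 ≤ j → a j ≤ a (j + 1))
    (hb : ∀ j, 1 ≤ j → c ≤ b j) {C p q : ℝ} (hC : 0 < C) (hp : 0 ≤ p) (hq : 0 ≤ q)
    (h : PBound w a b C p q) :
    ∀ᶠ d : ℕ in atTop, (1 + 1 / (p + 1)) * Real.log d ≤ a d * Real.log w⁻¹ := by
  classical
  set s := 1 + 1 / (p + 1) with hs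
  set r : ℕ := ⌈2 * q⌉₊ + 2 with hr
  have hrq : 2 * q + 2 ≤ r := by
    rw [hr]; push_cast; linarith [Nat.le_ceil (2 * q)]
  set c0 : ℝ := 1 / (2 ^ r * r.factorial) with hc0
  have hc0p : 0 < c0 := by positivity
  have hc01 : c0 ≤ 1 := by
    rw [hc0, div_le_one (by positivity)]
    have h1 : (1:ℝ) ≤ 2 ^ r := one_le_pow₀ (by norm_num)
    have h2 : (1:ℝ) ≤ r.factorial := by exact_mod_cast Nat.factorial_pos r
    nlinarith
  set X : ℝ := C * (c0 / 4) ^ (-(p / 2)) / (3 / 4 * c0) with hX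
  filter_upwards [eventually_ge_atTop (2 * r), eventually_ge_atTop 1,
    eventually_gt_atTop ⌈X⌉₊] with d hd2 hd1 hdX
  by_contra hcon
  push Not at hcon
  have hdX : X < d := lt_of_le_of_lt (Nat.le_ceil X) (by exact_mod_cast hdX)
  have hd0 : (0:ℝ) < d := by exact_mod_cast hd1
  have hd1' : (1:ℝ) ≤ d := by exact_mod_cast hd1
  -- the test set
  let ind : Finset (Fin d) → (Fin d → ℤ) := fun S j => if j ∈ S then 1 else 0
  have hinj : Function.Injective ind := by
    intro S S' hSS
    ext j
    have := congrFun hSS j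
    by_cases h1 : j ∈ S <;> by_cases h2 : j ∈ S' <;> simp_all [ind]
  set B := (Finset.powersetCard r (Finset.univ : Finset (Fin d))).image ind with hB
  have hBc : B.card = d.choose r := by
    rw [hB, Finset.card_image_of_injective _ hinj, Finset.card_powersetCard]; simp
  have hBge : c0 * (d : ℝ) ^ r ≤ B.card := by
    rw [hBc]
    refine le_trans ?_ (Nat.pow_le_choose (α := ℝ) r d)
    have h1 : (d : ℝ) / 2 ≤ ((d + 1 - r : ℕ) : ℝ) := by
      have : d ≤ 2 * (d + 1 - r) := by omega
      have : (d : ℝ) ≤ 2 * ((d + 1 - r : ℕ) : ℝ) := by exact_mod_cast this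
      linarith
    have h2 : c0 * (d : ℝ) ^ r = ((d : ℝ) / 2) ^ r / r.factorial := by
      rw [hc0, div_pow]; field_simp
    rw [h2]
    gcongr
  set t : ℝ := (d : ℝ) ^ (-(s * r)) with ht
  have ht0 : 0 < t := by positivity
  have htB : ∀ k ∈ B, t ≤ rho w a b d k := by
    intro k hk
    obtain ⟨S, hS, rfl⟩ := Finset.mem_image.mp hk
    have hSc := (Finset.mem_powersetCard.mp hS).2
    unfold rho
    have h1 : ∑ j : Fin d, a (j.1 + 1) * (|(ind S j : ℝ)|) ^ b (j.1 + 1) ≤ r * a d := by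
      have : ∀ j : Fin d, a (j.1 + 1) * (|(ind S j : ℝ)|) ^ b (j.1 + 1) ≤
          if j ∈ S then a d else 0 := by
        intro j
        have hbj : 0 < b (j.1 + 1) := hc.trans_le (hb _ (by omega))
        by_cases hj : j ∈ S
        · simp [ind, hj]
          exact a_ge hamono (by omega) (by omega)
        · simp [ind, hj, Real.zero_rpow hbj.ne']
      refine (Finset.sum_le_sum fun j _ => this j).trans (le_of_eq ?_)
      rw [Finset.sum_ite_mem, Finset.univ_inter, Finset.sum_const, hSc, nsmul_eq_mul]
    refine le_trans ?_ (Real.rpow_le_rpow_of_exponent_ge hw.1 hw.2.le h1)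
    rw [ht, Real.rpow_def_of_pos hw.1, Real.rpow_def_of_pos hd0, Real.exp_le_exp]
    have e : Real.log w = - Real.log w⁻¹ := by rw [Real.log_inv]; ring
    rw [e]
    have hr0 : (0:ℝ) ≤ r := by positivity
    nlinarith [mul_le_mul_of_nonneg_left hcon.le hr0]
  set ε : ℝ := Real.sqrt (c0 / 4) * (d : ℝ) ^ (-((s - 1) * r / 2)) with hε
  have hs1 : 0 ≤ s - 1 := by rw [hs]; simp; positivity
  have hε0 : 0 < ε := by positivity
  have hε1 : ε < 1 := by
    have h1 : Real.sqrt (c0 / 4) < 1 := by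
      rw [Real.sqrt_lt' one_pos]; linarith
    have h2 : (d : ℝ) ^ (-((s - 1) * r / 2)) ≤ 1 := by
      apply Real.rpow_le_one_of_one_le_of_nonpos hd1'
      have : 0 ≤ (s - 1) * r / 2 := by positivity
      linarith
    have h3 : 0 < (d : ℝ) ^ (-((s - 1) * r / 2)) := by positivity
    have h4 : 0 ≤ Real.sqrt (c0 / 4) := Real.sqrt_nonneg _
    nlinarith
  have hεsq : ε ^ 2 = t * (c0 / 4 * (d : ℝ) ^ r) := by
    rw [hε, mul_pow, Real.sq_sqrt (by positivity), ht, ← Real.rpow_natCast, ← Real.rpow_natCast,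
      ← Real.rpow_mul hd0.le]
    rw [show ∀ x y z : ℝ, x * (y * z) = y * (x * z) by intros; ring, ← Real.rpow_add hd0]
    congr 2
    push_cast; ring
  obtain ⟨n, hn1, hn2⟩ := h d hd1 ε ⟨hε0, hε1⟩
  have hlow := (lower_card hw hc hapos hamono hb d n B t ht0.le htB).trans hn2
  rw [ENNReal.ofReal_le_ofReal_iff hε0.le, Real.sqrt_le_iff, hεsq] at hlow
  have hlow2 := le_of_mul_le_mul_left hlow.2 ht0
  have hnlow : 3 / 4 * c0 * (d : ℝ) ^ r ≤ n := by linarith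
  have hεp : ε ^ (-p) ≤ (c0 / 4) ^ (-(p / 2)) * (d : ℝ) ^ ((r : ℝ) / 2) := by
    rw [hε, Real.mul_rpow (Real.sqrt_nonneg _) (by positivity), Real.sqrt_eq_rpow,
      ← Real.rpow_mul (by positivity), ← Real.rpow_mul hd0.le]
    have e1 : 1 / 2 * -p = -(p / 2) := by ring
    rw [e1]
    refine mul_le_mul_of_nonneg_left (Real.rpow_le_rpow_of_exponent_le hd1' ?_) (by positivity)
    have e2 : (s - 1) * p ≤ 1 := by
      rw [hs, add_sub_cancel_left, one_div, inv_mul_le_iff₀ (by positivity)]; linarith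
    have hr0 : (0:ℝ) ≤ r := by positivity
    nlinarith [mul_le_mul_of_nonneg_right e2 hr0]
  have hfin : 3 / 4 * c0 * (d : ℝ) ^ r ≤ C * (c0 / 4) ^ (-(p / 2)) * (d : ℝ) ^ ((r : ℝ) - 1) := by
    calc 3 / 4 * c0 * (d : ℝ) ^ r ≤ C * (d : ℝ) ^ q * ε ^ (-p) := hnlow.trans hn1
      _ ≤ C * (d : ℝ) ^ q * ((c0 / 4) ^ (-(p / 2)) * (d : ℝ) ^ ((r : ℝ) / 2)) := by gcongr
      _ = C * (c0 / 4) ^ (-(p / 2)) * (d : ℝ) ^ (q + (r : ℝ) / 2) := by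
          rw [Real.rpow_add hd0]; ring
      _ ≤ _ := by
          refine mul_le_mul_of_nonneg_left (Real.rpow_le_rpow_of_exponent_le hd1' ?_) (by positivity)
          linarith
  have e3 : (d : ℝ) ^ r = d * (d : ℝ) ^ ((r : ℝ) - 1) := by
    rw [Real.rpow_sub hd0, Real.rpow_natCast, Real.rpow_one]; field_simp
  rw [e3, ← mul_assoc] at hfin
  have hfin2 := le_of_mul_le_mul_right hfin (by positivity)
  rw [hX, div_lt_iff₀ (by positivity)] at hdX
  linarith

lemma pt_cond {w : ℝ} (hw : w ∈ Set.Ioo (0:ℝ) 1) {a b : ℕ → ℝ} {c : ℝ} (hc : 0 < c)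
    (hapos : 0 < a 1) (hamono : ∀ j, 1 ≤ j → a j ≤ a (j + 1))
    (hb : ∀ j, 1 ≤ j → c ≤ b j) (crit : Crit) (useStd : Bool)
    (h : ALGPT (expKorNC w a b useStd crit)) :
    ((1 / Real.log w⁻¹ : ℝ) : EReal) <
        Filter.liminf (fun j : ℕ => ((a j / Real.log j : ℝ) : EReal)) Filter.atTop := by
  obtain ⟨C, hC, p, hp, q, hq, hP⟩ := pt_pbound hw hc hapos hamono hb crit useStd h
  have hev := pbound_ev hw hc hapos hamono hb hC hp hq hP
  have hlw : 0 < Real.log w⁻¹ := Real.log_pos ((one_lt_inv₀ hw.1).mpr hw.2)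
  have hlt : 1 / Real.log w⁻¹ < (1 + 1 / (p + 1)) / Real.log w⁻¹ := by
    apply div_lt_div_of_pos_right _ hlw
    have : 0 < 1 / (p + 1) := by positivity
    linarith
  refine lt_of_lt_of_le (EReal.coe_lt_coe_iff.mpr hlt) ?_
  refine Filter.le_liminf_of_le (by isBoundedDefault) ?_
  filter_upwards [hev, eventually_ge_atTop 2] with j hj hj2
  have hj0 : (1:ℝ) < j := by exact_mod_cast hj2
  have hlj : 0 < Real.log j := Real.log_pos hj0
  rw [EReal.coe_le_coe_iff, div_le_div_iff₀ hlw hlj]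
  exact hj

/-- For the Korobov spaces with exponential weight (`ω ∈ (0,1)`,
`0 < a₁ ≤ a₂ ≤ ⋯`, `inf_j b_j > 0`), for either information class and either error
criterion, ALG-SPT ⟺ ALG-PT ⟺ `liminf_j a_j / ln j > 1 / ln ω⁻¹`. -/
theorem stmt16
    (w : ℝ) (hw : w ∈ Set.Ioo (0:ℝ) 1)
    (a b : ℕ → ℝ)
    (hapos : 0 < a 1) (hamono : ∀ j, 1 ≤ j → a j ≤ a (j + 1))
    (hb : ∃ c > (0:ℝ), ∀ j, 1 ≤ j → c ≤ b j)
    (crit : Crit) (useStd : Bool) :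
    (ALGSPT (expKorNC w a b useStd crit) ↔ ALGPT (expKorNC w a b useStd crit)) ∧
    (ALGPT (expKorNC w a b useStd crit) ↔
      ((1 / Real.log w⁻¹ : ℝ) : EReal) <
        Filter.liminf (fun j : ℕ => ((a j / Real.log j : ℝ) : EReal)) Filter.atTop) := by
  obtain ⟨c, hc, hbc⟩ := hb
  have h1 : ALGSPT (expKorNC w a b useStd crit) → ALGPT (expKorNC w a b useStd crit) := by
    rintro ⟨C, hC, p, hp, h⟩
    refine ⟨C, hC, p, hp, 0, le_rfl, fun d hd ε hε => ?_⟩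
    simpa using h d hd ε hε
  have h2 := pt_cond hw hc hapos hamono hbc crit useStd
  have h3 := cond_spt hw hc hapos hamono hbc crit useStd
  exact ⟨⟨h1, fun h => h3 (h2 h)⟩, ⟨h2, fun h => h1 (h3 h)⟩⟩
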